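/- Let p ≥ 3 be a natural number and define F₂ as in the context. Then for all integers a ≥ 1, b ≥ 1 and all real t ≥ 0, ∑_{k,l ≥ 1, k+l < p} F₂(pa+k, pb+l; t) + ∑_{1 ≤ k,l ≤ p−1, k+l > p} F₂(pa+k, pb+l; t) > 0. -/

import Mathlib

noncomputable def A (p k : ℕ) : ℝ :=
  if k = p then Real.pi / (2 * (p : ℝ)^2)
  else Real.sin (Real.pi * k / p) / ((p : ℝ)^2 - (k : ℝ)^2)

noncomputable def B (p k : ℕ) : ℝ :=
  if k = 2 * p then -(Real.pi / (2 * (p : ℝ)))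
  else (k : ℝ) * Real.sin (Real.pi * k / p) / (4 * (p : ℝ)^2 - (k : ℝ)^2)

noncomputable def F1 (p k l : ℕ) (t : ℝ) : ℝ :=
  A p k * A p (k + l) * B p l *
    Real.exp (-((k : ℝ)^2 + (l : ℝ)^2 + ((k : ℝ) + (l : ℝ))^2) * t)

noncomputable def F2 (p k l : ℕ) (t : ℝ) : ℝ :=
  -(A p k * A p l * B p (k + l)) *
    Real.exp (-((k : ℝ)^2 + (l : ℝ)^2 + ((k : ℝ) + (l : ℝ))^2) * t)

/-- The factor of `F2 p m n t` left after removing the sines. -/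
noncomputable def decayWeight (p m n t : ℝ) : ℝ :=
  (m + n) / ((m ^ 2 - p ^ 2) * (n ^ 2 - p ^ 2) * ((m + n) ^ 2 - 4 * p ^ 2)) *
    Real.exp (-(m ^ 2 + n ^ 2 + (m + n) ^ 2) * t)

/-- Beyond its poles, `s / (s² - c²)` is decreasing. -/
theorem div_sq_sub_sq_lt {c s s' : ℝ} (hc : 0 ≤ c) (hs : c < s) (hss : s < s') :
    s' / (s' ^ 2 - c ^ 2) < s / (s ^ 2 - c ^ 2) := by
  have h1 : 0 < s ^ 2 - c ^ 2 := by nlinarith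
  have h2 : 0 < s' ^ 2 - c ^ 2 := by nlinarith
  rw [div_lt_div_iff₀ h2 h1]
  have h3 : 0 < s * s' := mul_pos (by linarith) (by linarith)
  nlinarith [mul_pos (sub_pos.2 hss) h3, mul_nonneg (sub_pos.2 hss).le (sq_nonneg c)]

theorem decayWeight_lt {p m n m' n' t : ℝ} (hp : 0 ≤ p) (hm : p < m) (hn : p < n)
    (hmm : m < m') (hnn : n < n') (ht : 0 ≤ t) :
    decayWeight p m' n' t < decayWeight p m n t := by
  have split : ∀ u v : ℝ, decayWeight p u v t = (u + v) / ((u + v) ^ 2 - (2 * p) ^ 2) *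
      (1 / (u ^ 2 - p ^ 2)) * (1 / (v ^ 2 - p ^ 2)) *
        Real.exp (-(u ^ 2 + v ^ 2 + (u + v) ^ 2) * t) := by
    intro u v
    unfold decayWeight
    rw [div_mul_div_comm, div_mul_div_comm]
    ring_nf
  have hm0 : 0 < m ^ 2 - p ^ 2 := by nlinarith
  have hn0 : 0 < n ^ 2 - p ^ 2 := by nlinarith
  have hm1 : m ^ 2 - p ^ 2 ≤ m' ^ 2 - p ^ 2 := by nlinarith
  have hn1 : n ^ 2 - p ^ 2 ≤ n' ^ 2 - p ^ 2 := by nlinarith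
  have hm2 : 0 < m' ^ 2 - p ^ 2 := by linarith
  have hn2 : 0 < n' ^ 2 - p ^ 2 := by linarith
  have hs1 : 0 < (m + n) ^ 2 - (2 * p) ^ 2 := by nlinarith
  have hpos : 0 < (m + n) / ((m + n) ^ 2 - (2 * p) ^ 2) := div_pos (by linarith) hs1
  have hexp : -(m' ^ 2 + n' ^ 2 + (m' + n') ^ 2) * t ≤ -(m ^ 2 + n ^ 2 + (m + n) ^ 2) * t := by
    apply mul_le_mul_of_nonneg_right _ ht
    nlinarith
  rw [split, split]
  calc _ < (m + n) / ((m + n) ^ 2 - (2 * p) ^ 2) *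
      (1 / (m' ^ 2 - p ^ 2)) * (1 / (n' ^ 2 - p ^ 2)) *
        Real.exp (-(m' ^ 2 + n' ^ 2 + (m' + n') ^ 2) * t) := by
        gcongr ?_ * _ * _ * _
        exact div_sq_sub_sq_lt (by linarith) (by linarith) (by linarith)
    _ ≤ _ := by gcongr

theorem sin_pi_mul_shift {p : ℕ} (hp : p ≠ 0) (a k : ℕ) :
    Real.sin (Real.pi * ((p * a + k : ℕ) : ℝ) / p) = (-1) ^ a * Real.sin (Real.pi * k / p) := by
  have hp' : (p : ℝ) ≠ 0 := by exact_mod_cast hp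
  rw [← Real.sin_add_nat_mul_pi]
  congr 1
  push_cast
  field_simp
  ring

theorem F2_shift {p a b k l : ℕ} (hp : p ≠ 0) (ha : 1 ≤ a) (hb : 1 ≤ b) (hk : 1 ≤ k)
    (hl : 1 ≤ l) (t : ℝ) :
    F2 p (p * a + k) (p * b + l) t =
      Real.sin (Real.pi * k / p) * Real.sin (Real.pi * l / p) *
        Real.sin (Real.pi * (k + l : ℕ) / p) *
          decayWeight p (p * a + k : ℕ) (p * b + l : ℕ) t := by
  have h1 : p ≤ p * a := Nat.le_mul_of_pos_right p ha
  have h2 : p ≤ p * b := Nat.le_mul_of_pos_right p hb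
  have hsum : p * a + k + (p * b + l) = p * (a + b) + (k + l) := by ring
  have hsq : ((-1 : ℝ) ^ a * (-1) ^ b) * (-1) ^ (a + b) = 1 := by
    rw [← pow_add, ← mul_pow]; norm_num
  unfold F2 A B decayWeight
  rw [if_neg (by omega), if_neg (by omega), if_neg (by omega), hsum, sin_pi_mul_shift hp,
    sin_pi_mul_shift hp, sin_pi_mul_shift hp, ← hsum, Nat.cast_add (p * a + k)]
  generalize ((p * a + k : ℕ) : ℝ) = x
  generalize ((p * b + l : ℕ) : ℝ) = y
  rw [← mul_assoc, ← neg_sub (x ^ 2), ← neg_sub (y ^ 2), ← neg_sub ((x + y) ^ 2)]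
  simp only [div_eq_mul_inv, mul_inv, inv_neg]
  generalize (x ^ 2 - (p : ℝ) ^ 2)⁻¹ = X
  generalize (y ^ 2 - (p : ℝ) ^ 2)⁻¹ = Y
  generalize ((x + y) ^ 2 - 4 * (p : ℝ) ^ 2)⁻¹ = Z
  generalize Real.exp _ = E
  generalize Real.sin (Real.pi * k * (p : ℝ)⁻¹) = S
  generalize Real.sin (Real.pi * l * (p : ℝ)⁻¹) = T
  generalize Real.sin (Real.pi * (k + l : ℕ) * (p : ℝ)⁻¹) = U
  linear_combination (S * T * U * (x + y) * X * Y * Z * E) * hsq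

theorem sin_pi_mul_div_pos {p k : ℕ} (hk : 0 < k) (hkp : k < p) :
    0 < Real.sin (Real.pi * k / p) := by
  have hk' : (0 : ℝ) < k := by exact_mod_cast hk
  have hkp' : (k : ℝ) < p := by exact_mod_cast hkp
  have hp' : (0 : ℝ) < p := hk'.trans hkp'
  apply Real.sin_pos_of_pos_of_lt_pi
  · positivity
  · rw [div_lt_iff₀ hp']
    exact mul_lt_mul_of_pos_left hkp' Real.pi_pos

theorem sin_pi_mul_reflect {p k : ℕ} (hp : p ≠ 0) (hk : k ≤ p) :
    Real.sin (Real.pi * (p - k : ℕ) / p) = Real.sin (Real.pi * k / p) := by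
  have hp' : (p : ℝ) ≠ 0 := by exact_mod_cast hp
  rw [← Real.sin_pi_sub, Nat.cast_sub hk]
  congr 1
  field_simp
  ring

/-- Each term below the antidiagonal outweighs its mirror image above it. -/
theorem F2_add_reflect_pos {p a b k l : ℕ} (ha : 1 ≤ a) (hb : 1 ≤ b) (hk : 1 ≤ k)
    (hl : 1 ≤ l) (hkl : k + l < p) {t : ℝ} (ht : 0 ≤ t) :
    0 < F2 p (p * a + k) (p * b + l) t + F2 p (p * a + (p - l)) (p * b + (p - k)) t := by
  have hp : p ≠ 0 := by omega
  have h1 : p ≤ p * a := Nat.le_mul_of_pos_right p ha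
  have h2 : p ≤ p * b := Nat.le_mul_of_pos_right p hb
  have hsin : Real.sin (Real.pi * (p - l + (p - k) : ℕ) / p) =
      -Real.sin (Real.pi * (k + l : ℕ) / p) := by
    have := sin_pi_mul_shift hp 1 (p - (k + l))
    rw [sin_pi_mul_reflect hp hkl.le] at this
    rw [show p - l + (p - k) = p * 1 + (p - (k + l)) by omega, this]
    ring
  rw [F2_shift hp ha hb hk hl, F2_shift hp ha hb (by omega) (by omega), hsin,
    sin_pi_mul_reflect hp (by omega), sin_pi_mul_reflect hp (by omega)]
  have hW : decayWeight p (p * a + (p - l) : ℕ) (p * b + (p - k) : ℕ) t <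
      decayWeight p (p * a + k : ℕ) (p * b + l : ℕ) t := by
    apply decayWeight_lt (Nat.cast_nonneg p) _ _ _ _ ht <;>
      exact Nat.cast_lt.2 (by omega)
  have hS := mul_pos (mul_pos (sin_pi_mul_div_pos hk (by omega : k < p))
    (sin_pi_mul_div_pos hl (by omega : l < p))) (sin_pi_mul_div_pos (by omega) hkl)
  linarith [mul_pos hS (sub_pos.2 hW)]

theorem sum_Ico_one_reflect (p : ℕ) (hp : 1 ≤ p) (f : ℕ → ℝ) :
    ∑ k ∈ Finset.Ico 1 p, f (p - k) = ∑ k ∈ Finset.Ico 1 p, f k := by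
  have h := Finset.sum_Ico_reflect f 1 (m := p) (n := p) (by omega)
  rwa [show p + 1 - p = 1 by omega, show p + 1 - 1 = p by omega] at h

theorem L_square_pos (p : ℕ) (hp : 3 ≤ p) (a b : ℕ) (ha : 1 ≤ a) (hb : 1 ≤ b)
    (t : ℝ) (ht : 0 ≤ t) :
    0 < (∑ k ∈ Finset.Ico 1 p, ∑ l ∈ Finset.Ico 1 p,
          if k + l < p then F2 p (p * a + k) (p * b + l) t else 0)
      + (∑ k ∈ Finset.Ico 1 p, ∑ l ∈ Finset.Ico 1 p,
          if p < k + l then F2 p (p * a + k) (p * b + l) t else 0) := by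
  have hreflect : (∑ k ∈ Finset.Ico 1 p, ∑ l ∈ Finset.Ico 1 p,
          if p < k + l then F2 p (p * a + k) (p * b + l) t else 0) =
      ∑ k ∈ Finset.Ico 1 p, ∑ l ∈ Finset.Ico 1 p,
          if k + l < p then F2 p (p * a + (p - l)) (p * b + (p - k)) t else 0 := by
    rw [Finset.sum_comm, ← sum_Ico_one_reflect p (by omega)]
    refine Finset.sum_congr rfl fun k hk => ?_
    rw [← sum_Ico_one_reflect p (by omega)]
    refine Finset.sum_congr rfl fun l hl => ?_
    rw [Finset.mem_Ico] at hk hl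
    exact if_congr (by omega) rfl rfl
  have hterm : ∀ k ∈ Finset.Ico 1 p, ∀ l ∈ Finset.Ico 1 p,
      0 ≤ (if k + l < p then F2 p (p * a + k) (p * b + l) t else 0) +
        (if k + l < p then F2 p (p * a + (p - l)) (p * b + (p - k)) t else 0) := by
    intro k hk l hl
    rw [Finset.mem_Ico] at hk hl
    split_ifs with h
    · exact (F2_add_reflect_pos ha hb hk.1 hl.1 h ht).le
    · simp
  have hone : 1 ∈ Finset.Ico 1 p := Finset.mem_Ico.2 ⟨le_rfl, by omega⟩
  rw [hreflect, ← Finset.sum_add_distrib]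
  simp_rw [← Finset.sum_add_distrib]
  refine Finset.sum_pos' (fun k hk => Finset.sum_nonneg (hterm k hk)) ⟨1, hone, ?_⟩
  refine Finset.sum_pos' (hterm 1 hone) ⟨1, hone, ?_⟩
  rw [if_pos (by omega), if_pos (by omega)]
  exact F2_add_reflect_pos ha hb le_rfl le_rfl (by omega) ht
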